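/- Fix n ∈ ℕ, a complex number ħ, a matrix C : Fin n → Fin n → ℂ, and subsets S, T ⊆ Fin n. Suppose C i j = C j i for all i ∈ S and j ∈ T. Then for every polynomial F all of whose variables lie in S (i.e. ∂_i F = 0 for i ∉ S) and every polynomial G all of whose variables lie in T, one has F ⋆_C G = G ⋆_C F. (Einstein causality in the polynomial model: when the antisymmetric part of the propagator vanishes between two regions — as the causal propagator does for spacelike-separated regions — observables localized in those regions commute for the star product.) -/

import Mathlib

open MvPolynomial

/-- The iterated partial derivative of a multivariate polynomial. -/
noncomputable def pderivMulti {n k : ℕ} (i : Fin k → Fin n)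
    (F : MvPolynomial (Fin n) ℂ) : MvPolynomial (Fin n) ℂ :=
  (List.ofFn i).foldl (fun p r => MvPolynomial.pderiv r p) F

/-- The exponential product `F ⋆_C G` determined by a propagator matrix `C`. -/
noncomputable def expProd {n : ℕ} (hbar : ℂ) (C : Fin n → Fin n → ℂ)
    (F G : MvPolynomial (Fin n) ℂ) : MvPolynomial (Fin n) ℂ :=
  ∑ᶠ k : ℕ, (hbar ^ k / (k.factorial : ℂ)) •
    ∑ i : Fin k → Fin n, ∑ j : Fin k → Fin n,
      (∏ a : Fin k, C (i a) (j a)) • (pderivMulti i F * pderivMulti j G)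

theorem MvPolynomial.pderiv_comm {σ R : Type*} [CommRing R] (i j : σ) (F : MvPolynomial σ R) :
    pderiv i (pderiv j F) = pderiv j (pderiv i F) := by
  classical
  have h : ⁅pderiv (R := R) i, pderiv (R := R) j⁆ = 0 := by
    refine derivation_ext fun r => ?_
    rw [Derivation.commutator_apply, pderiv_X, pderiv_X]
    simp only [Pi.single_apply]
    split_ifs <;> simp
  have := congrArg (fun D => D F) h
  simpa [Derivation.commutator_apply, sub_eq_zero] using this

theorem MvPolynomial.foldl_pderiv_zero {σ R : Type*} [CommSemiring R] (l : List σ) :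
    l.foldl (fun p r => pderiv r p) (0 : MvPolynomial σ R) = 0 := by
  induction l with
  | nil => rfl
  | cons r l ih => simpa using ih

theorem MvPolynomial.foldl_pderiv_eq_zero {σ R : Type*} [CommRing R] {l : List σ} {r : σ}
    (hr : r ∈ l) {F : MvPolynomial σ R} (hF : pderiv r F = 0) :
    l.foldl (fun p r => pderiv r p) F = 0 := by
  induction l generalizing F with
  | nil => simp at hr
  | cons s l ih =>
    rw [List.foldl_cons]
    rcases List.mem_cons.1 hr with rfl | hr
    · rw [hF, foldl_pderiv_zero]
    · exact ih hr (by rw [pderiv_comm, hF, map_zero])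

theorem pderivMulti_eq_zero {n k : ℕ} {i : Fin k → Fin n} {F : MvPolynomial (Fin n) ℂ}
    (a : Fin k) (h : pderiv (i a) F = 0) : pderivMulti i F = 0 :=
  foldl_pderiv_eq_zero (List.mem_ofFn.2 ⟨a, rfl⟩) h

/-- Einstein causality in the polynomial model: if the
antisymmetric part of the propagator vanishes between regions `S` and `T`,
then observables localized in `S` commute with observables localized in `T`
for the star product `⋆_C`. -/
theorem expProd_einstein_causality {n : ℕ} (hbar : ℂ)
    (C : Fin n → Fin n → ℂ) (S T : Set (Fin n))
    (hsymm : ∀ i ∈ S, ∀ j ∈ T, C i j = C j i)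
    (F G : MvPolynomial (Fin n) ℂ)
    (hF : ∀ i : Fin n, i ∉ S → MvPolynomial.pderiv i F = 0)
    (hG : ∀ j : Fin n, j ∉ T → MvPolynomial.pderiv j G = 0) :
    expProd hbar C F G = expProd hbar C G F := by
  unfold expProd
  refine finsum_congr fun k => congrArg _ ?_
  rw [Finset.sum_comm]
  refine Finset.sum_congr rfl fun j _ => Finset.sum_congr rfl fun i _ => ?_
  by_cases hi : ∀ a, i a ∈ S
  · by_cases hj : ∀ a, j a ∈ T
    · rw [mul_comm, Finset.prod_congr rfl fun a _ => hsymm _ (hi a) _ (hj a)]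
    · obtain ⟨a, ha⟩ := not_forall.1 hj
      simp [pderivMulti_eq_zero a (hG _ ha)]
  · obtain ⟨a, ha⟩ := not_forall.1 hi
    simp [pderivMulti_eq_zero a (hF _ ha)]
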